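/- Let n ≥ 1 be an integer, p > 1 a real number, and let u : ℝⁿ → ℝ be a C^∞ stable solution of Δ⁴u = |u|^{p−1}u on ℝⁿ. Then there is a constant C > 0 (depending on n, p and u but not on R) such that for every R > 0: (i) ∫_{B_R(0)} (|u|^{p+1} + |Δ²u|²) dx ≤ C·R^{−8}·∫_{B_{2R}(0)} u² dx, and (ii) ∫_{B_R(0)} (|u|^{p+1} + |Δ²u|²) dx ≤ C·R^{n − 8(p+1)/(p−1)}. -/

import Mathlib

open MeasureTheory Real

noncomputable def lap {n : ℕ} (f : EuclideanSpace ℝ (Fin n) → ℝ) :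
    EuclideanSpace ℝ (Fin n) → ℝ :=
  fun x => ∑ i : Fin n,
    iteratedFDeriv ℝ 2 f x ![EuclideanSpace.single i 1, EuclideanSpace.single i 1]

open scoped ContDiff

noncomputable def pd {n : ℕ} (i : Fin n) (f : EuclideanSpace ℝ (Fin n) → ℝ) :
    EuclideanSpace ℝ (Fin n) → ℝ :=
  fun x => fderiv ℝ f x (EuclideanSpace.single i 1)

section Calculus

variable {n : ℕ} {f g : EuclideanSpace ℝ (Fin n) → ℝ}

lemma ContDiff.differentiableAt_of_smooth (hf : ContDiff ℝ ∞ f)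
    (x : EuclideanSpace ℝ (Fin n)) : DifferentiableAt ℝ f x :=
  (hf.differentiable (by simp)) x

lemma ContDiff.pd (hf : ContDiff ℝ ∞ f) (i : Fin n) : ContDiff ℝ ∞ (pd i f) :=
  (hf.fderiv_right (m := ∞) (by simp)).clm_apply contDiff_const

lemma lap_eq_sum_pd (hf : ContDiff ℝ ∞ f) : lap f = fun x => ∑ i, pd i (pd i f) x := by
  funext x
  refine Finset.sum_congr rfl fun i _ => ?_
  have hd : DifferentiableAt ℝ (fderiv ℝ f) x :=
    (hf.fderiv_right (m := ∞) (by simp)).differentiable (by simp) x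
  rw [iteratedFDeriv_two_apply]
  unfold pd
  rw [fderiv_clm_apply hd (differentiableAt_const _)]
  simp

lemma ContDiff.lap (hf : ContDiff ℝ ∞ f) : ContDiff ℝ ∞ (lap f) := by
  rw [lap_eq_sum_pd hf]
  exact ContDiff.sum fun i _ => (hf.pd i).pd i

lemma pd_comm (hf : ContDiff ℝ ∞ f) (i j : Fin n) : pd i (pd j f) = pd j (pd i f) := by
  funext x
  have hd : DifferentiableAt ℝ (fderiv ℝ f) x :=
    (hf.fderiv_right (m := ∞) (by simp)).differentiable (by simp) x
  have hs : IsSymmSndFDerivAt ℝ f x :=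
    hf.contDiffAt.isSymmSndFDerivAt (by simpa using WithTop.coe_le_coe.2 (le_top (a := (2 : ℕ∞))))
  unfold pd
  rw [fderiv_clm_apply hd (differentiableAt_const _),
    fderiv_clm_apply hd (differentiableAt_const _)]
  simpa using hs _ _

lemma pd_add (hf : ContDiff ℝ ∞ f) (hg : ContDiff ℝ ∞ g) (i : Fin n) :
    pd i (fun x => f x + g x) = fun x => pd i f x + pd i g x := by
  funext x
  simp only [pd]
  rw [fderiv_fun_add (hf.differentiableAt_of_smooth x) (hg.differentiableAt_of_smooth x)]
  simp

lemma pd_mul (hf : ContDiff ℝ ∞ f) (hg : ContDiff ℝ ∞ g) (i : Fin n) :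
    pd i (fun x => f x * g x) = fun x => f x * pd i g x + g x * pd i f x := by
  funext x
  simp only [pd]
  rw [fderiv_fun_mul (hf.differentiableAt_of_smooth x) (hg.differentiableAt_of_smooth x)]
  simp

lemma pd_pow (hf : ContDiff ℝ ∞ f) (i : Fin n) (k : ℕ) :
    pd i (fun x => f x ^ (k + 1)) = fun x => (k + 1) * f x ^ k * pd i f x := by
  funext x
  simp only [pd]
  rw [fderiv_fun_pow _ (hf.differentiableAt_of_smooth x)]
  simp

lemma pd_sum {ι : Type*} (s : Finset ι) {F : ι → EuclideanSpace ℝ (Fin n) → ℝ}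
    (hF : ∀ j, ContDiff ℝ ∞ (F j)) (i : Fin n) :
    pd i (fun x => ∑ j ∈ s, F j x) = fun x => ∑ j ∈ s, pd i (F j) x := by
  funext x
  simp only [pd]
  rw [fderiv_fun_sum fun j _ => (hF j).differentiableAt_of_smooth x]
  simp

lemma pd_const_mul (hf : ContDiff ℝ ∞ f) (i : Fin n) (c : ℝ) :
    pd i (fun x => c * f x) = fun x => c * pd i f x := by
  funext x
  simp only [pd]
  rw [fderiv_const_mul (hf.differentiableAt_of_smooth x)]
  simp

lemma lap_add (hf : ContDiff ℝ ∞ f) (hg : ContDiff ℝ ∞ g) :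
    lap (fun x => f x + g x) = fun x => lap f x + lap g x := by
  rw [lap_eq_sum_pd (hf.add hg), lap_eq_sum_pd hf, lap_eq_sum_pd hg]
  funext x
  rw [← Finset.sum_add_distrib]
  refine Finset.sum_congr rfl fun i _ => ?_
  rw [pd_add hf hg, pd_add (hf.pd i) (hg.pd i)]

lemma lap_const_mul (hf : ContDiff ℝ ∞ f) (c : ℝ) :
    lap (fun x => c * f x) = fun x => c * lap f x := by
  rw [lap_eq_sum_pd (contDiff_const.mul hf), lap_eq_sum_pd hf]
  funext x
  rw [Finset.mul_sum]
  refine Finset.sum_congr rfl fun i _ => ?_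
  rw [pd_const_mul hf, pd_const_mul (hf.pd i)]

lemma lap_sum {ι : Type*} (s : Finset ι) {F : ι → EuclideanSpace ℝ (Fin n) → ℝ}
    (hF : ∀ j, ContDiff ℝ ∞ (F j)) :
    lap (fun x => ∑ j ∈ s, F j x) = fun x => ∑ j ∈ s, lap (F j) x := by
  rw [lap_eq_sum_pd (ContDiff.sum fun j _ => hF j)]
  simp only [lap_eq_sum_pd (hF _)]
  funext x
  rw [Finset.sum_comm]
  refine Finset.sum_congr rfl fun i _ => ?_
  rw [pd_sum s hF, pd_sum s fun j => (hF j).pd i]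

lemma pd_lap (hf : ContDiff ℝ ∞ f) (i : Fin n) : pd i (lap f) = lap (pd i f) := by
  rw [lap_eq_sum_pd hf, lap_eq_sum_pd (hf.pd i), pd_sum _ fun j => (hf.pd j).pd j]
  funext x
  refine Finset.sum_congr rfl fun j _ => ?_
  rw [pd_comm (hf.pd j) i j, pd_comm hf i j]

lemma lap_mul (hf : ContDiff ℝ ∞ f) (hg : ContDiff ℝ ∞ g) :
    lap (fun x => f x * g x) =
      fun x => f x * lap g x + (2 * ∑ i, pd i f x * pd i g x + g x * lap f x) := by
  rw [lap_eq_sum_pd (hf.mul hg), lap_eq_sum_pd hf, lap_eq_sum_pd hg]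
  funext x
  rw [Finset.mul_sum, Finset.mul_sum, Finset.mul_sum, ← Finset.sum_add_distrib,
    ← Finset.sum_add_distrib]
  refine Finset.sum_congr rfl fun i _ => ?_
  rw [pd_mul hf hg, pd_add (hf.mul (hg.pd i)) (hg.mul (hf.pd i)), pd_mul hf (hg.pd i),
    pd_mul hg (hf.pd i)]
  ring

lemma lap_lap_mul (hf : ContDiff ℝ ∞ f) (hg : ContDiff ℝ ∞ g)
    (x : EuclideanSpace ℝ (Fin n)) :
    lap (lap fun x => f x * g x) x =
      g x * lap (lap f) x + f x * lap (lap g) x + 4 * ∑ i, pd i f x * pd i (lap g) x +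
        2 * (lap f x * lap g x) + 4 * ∑ i, ∑ j, pd j (pd i f) x * pd j (pd i g) x +
        4 * ∑ i, pd i (lap f) x * pd i g x := by
  have hs : ContDiff ℝ ∞ fun x => ∑ i, pd i f x * pd i g x :=
    ContDiff.sum fun i _ => (hf.pd i).mul (hg.pd i)
  rw [lap_mul hf hg, lap_add (hf.mul hg.lap) ((contDiff_const.mul hs).add (hg.mul hf.lap)),
    lap_add (contDiff_const.mul hs) (hg.mul hf.lap), lap_const_mul hs,
    lap_sum _ fun i => (hf.pd i).mul (hg.pd i), lap_mul hf hg.lap, lap_mul hg hf.lap]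
  simp only [lap_mul (hf.pd _) (hg.pd _), ← pd_lap hf, ← pd_lap hg, Finset.sum_add_distrib,
    ← Finset.mul_sum]
  have h1 : ∑ i, pd i g x * pd i (lap f) x = ∑ i, pd i (lap f) x * pd i g x :=
    Finset.sum_congr rfl fun i _ => mul_comm _ _
  rw [h1]
  ring

lemma integral_pd_eq_zero (hf : ContDiff ℝ ∞ f) (hc : HasCompactSupport f) (i : Fin n) :
    ∫ x, pd i f x = 0 := by
  have hi : Integrable (pd i f) :=
    (hf.pd i).continuous.integrable_of_hasCompactSupport
      (hc.fderiv_apply (𝕜 := ℝ) _)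
  have := integral_mul_fderiv_eq_neg_fderiv_mul_of_integrable (μ := volume)
    (f := fun _ : EuclideanSpace ℝ (Fin n) => (1 : ℝ)) (g := f)
    (v := EuclideanSpace.single i 1) (by simp) (by simp only [one_mul]; exact hi)
    (by simpa using hf.continuous.integrable_of_hasCompactSupport hc)
    (fun x _ => differentiableAt_const _) (fun x _ => hf.differentiableAt_of_smooth x)
  simpa [pd] using this

lemma HasCompactSupport.pd (hc : HasCompactSupport f) (i : Fin n) :
    HasCompactSupport (pd i f) :=
  hc.fderiv_apply (𝕜 := ℝ) _

lemma HasCompactSupport.lap (hf : ContDiff ℝ ∞ f) (hc : HasCompactSupport f) :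
    HasCompactSupport (lap f) := by
  rw [lap_eq_sum_pd hf]
  refine HasCompactSupport.intro hc fun x hx => Finset.sum_eq_zero fun i _ => ?_
  have h : tsupport (_root_.pd i (_root_.pd i f)) ⊆ tsupport f :=
    (tsupport_fderiv_apply_subset ℝ _).trans (tsupport_fderiv_apply_subset ℝ _)
  exact image_eq_zero_of_notMem_tsupport fun hx' => hx (h hx')

lemma integral_lap_mul (hf : ContDiff ℝ ∞ f) (hg : ContDiff ℝ ∞ g)
    (hc : HasCompactSupport g) : ∫ x, lap f x * g x = ∫ x, f x * lap g x := by
  have hinteg : ∀ {h : EuclideanSpace ℝ (Fin n) → ℝ}, ContDiff ℝ ∞ h → HasCompactSupport h →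
      Integrable h := fun hh hhc => hh.continuous.integrable_of_hasCompactSupport hhc
  have hX : ∀ i, ContDiff ℝ ∞ fun x => g x * pd i f x := fun i => hg.mul (hf.pd i)
  have hY : ∀ i, ContDiff ℝ ∞ fun x => f x * pd i g x := fun i => hf.mul (hg.pd i)
  have hXc : ∀ i, HasCompactSupport fun x => g x * pd i f x := fun i => hc.mul_right
  have hYc : ∀ i, HasCompactSupport fun x => f x * pd i g x := fun i => (hc.pd i).mul_left
  have key : ∀ x, lap f x * g x - f x * lap g x =
      ∑ i, (pd i (fun x => g x * pd i f x) x - pd i (fun x => f x * pd i g x) x) := by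
    intro x
    rw [lap_eq_sum_pd hf, lap_eq_sum_pd hg, Finset.sum_mul, Finset.mul_sum,
      ← Finset.sum_sub_distrib]
    refine Finset.sum_congr rfl fun i _ => ?_
    rw [pd_mul hg (hf.pd i), pd_mul hf (hg.pd i)]
    ring
  rw [← sub_eq_zero, ← integral_sub (hinteg (hf.lap.mul hg) hc.mul_left)
    (hinteg (hf.mul hg.lap) (HasCompactSupport.lap hg hc).mul_left)]
  simp only [key]
  have hsub : ∀ i ∈ Finset.univ, Integrable fun x =>
      pd i (fun x => g x * pd i f x) x - pd i (fun x => f x * pd i g x) x := fun i _ =>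
    (hinteg ((hX i).pd i) ((hXc i).pd i)).sub (hinteg ((hY i).pd i) ((hYc i).pd i))
  rw [integral_finsetSum _ hsub]
  refine Finset.sum_eq_zero fun i _ => ?_
  rw [integral_sub (hinteg ((hX i).pd i) ((hXc i).pd i)) (hinteg ((hY i).pd i) ((hYc i).pd i)),
    integral_pd_eq_zero (hX i) (hXc i), integral_pd_eq_zero (hY i) (hYc i), sub_zero]

end Calculus

def HasOrder {n : ℕ} (ψ : EuclideanSpace ℝ (Fin n) → ℝ) (q : ℕ)
    (f : EuclideanSpace ℝ (Fin n) → ℝ) : Prop :=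
  ∃ g : EuclideanSpace ℝ (Fin n) → ℝ, ContDiff ℝ ∞ g ∧ f = fun x => ψ x ^ q * g x

section Cutoff

variable {n : ℕ} {ψ f : EuclideanSpace ℝ (Fin n) → ℝ} {q : ℕ}

lemma hasOrder_pow (q : ℕ) : HasOrder ψ q fun x => ψ x ^ q :=
  ⟨fun _ => 1, contDiff_const, by simp⟩

lemma HasOrder.pd (hψ : ContDiff ℝ ∞ ψ) (hf : HasOrder ψ (q + 1) f) (i : Fin n) :
    HasOrder ψ q (pd i f) := by
  obtain ⟨g, hg, rfl⟩ := hf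
  refine ⟨fun x => ψ x * _root_.pd i g x + g x * ((q + 1) * _root_.pd i ψ x),
    (hψ.mul (hg.pd i)).add (hg.mul (contDiff_const.mul (hψ.pd i))), ?_⟩
  rw [pd_mul (hψ.pow _) hg, pd_pow hψ]
  funext x
  ring

lemma HasOrder.contDiff (hψ : ContDiff ℝ ∞ ψ) (hf : HasOrder ψ q f) : ContDiff ℝ ∞ f := by
  obtain ⟨g, hg, rfl⟩ := hf
  exact (hψ.pow _).mul hg

lemma HasOrder.sum {ι : Type*} (s : Finset ι) {F : ι → EuclideanSpace ℝ (Fin n) → ℝ}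
    (hF : ∀ i, HasOrder ψ q (F i)) : HasOrder ψ q fun x => ∑ i ∈ s, F i x := by
  choose g hg hFg using hF
  refine ⟨fun x => ∑ i ∈ s, g i x, ContDiff.sum fun i _ => hg i, ?_⟩
  funext x
  rw [Finset.mul_sum]
  exact Finset.sum_congr rfl fun i _ => by rw [hFg i]

lemma HasOrder.lap (hψ : ContDiff ℝ ∞ ψ) (hf : HasOrder ψ (q + 2) f) :
    HasOrder ψ q (lap f) := by
  rw [lap_eq_sum_pd (hf.contDiff hψ)]
  exact HasOrder.sum _ fun i => (hf.pd hψ i).pd hψ i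

lemma HasOrder.exists_bound (hψ0 : ∀ x, 0 ≤ ψ x) (hc : HasCompactSupport ψ) (hq : q ≠ 0)
    (hf : HasOrder ψ q f) : ∃ C, ∀ x, |f x| ≤ C * ψ x ^ q := by
  obtain ⟨g, hg, rfl⟩ := hf
  obtain ⟨C, hC⟩ := hc.isCompact.exists_bound_of_continuousOn hg.continuous.continuousOn
  refine ⟨C, fun x => ?_⟩
  by_cases hx : x ∈ tsupport ψ
  · rw [abs_mul, abs_of_nonneg (pow_nonneg (hψ0 x) q), mul_comm]
    exact mul_le_mul_of_nonneg_right (hC x hx) (pow_nonneg (hψ0 x) q)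
  · simp [image_eq_zero_of_notMem_tsupport hx, hq]

lemma HasOrder.exists_bound_family {ι : Type*} [Fintype ι] (hψ0 : ∀ x, 0 ≤ ψ x)
    (hc : HasCompactSupport ψ) (hq : q ≠ 0) {F : ι → EuclideanSpace ℝ (Fin n) → ℝ}
    (hF : ∀ i, HasOrder ψ q (F i)) : ∃ C, ∀ i x, |F i x| ≤ C * ψ x ^ q := by
  choose C hC using fun i => (hF i).exists_bound hψ0 hc hq
  refine ⟨∑ i, |C i|, fun i x => (hC i x).trans ?_⟩
  refine mul_le_mul_of_nonneg_right ?_ (pow_nonneg (hψ0 x) q)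
  exact (le_abs_self _).trans
    (Finset.single_le_sum (f := fun i => |C i|) (fun _ _ => abs_nonneg _) (Finset.mem_univ i))

lemma integrable_mul_pow (hψ : ContDiff ℝ ∞ ψ) (hc : HasCompactSupport ψ) (hq : q ≠ 0)
    (hf : Continuous f) : Integrable fun x => f x * ψ x ^ q := by
  refine (hf.mul (hψ.continuous.pow q)).integrable_of_hasCompactSupport ?_
  exact HasCompactSupport.intro hc fun x hx => by
    simp [image_eq_zero_of_notMem_tsupport hx, hq]

lemma exists_integral_grad_sq_le (hψ : ContDiff ℝ ∞ ψ) (hc : HasCompactSupport ψ)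
    {j : ℕ} (hj : j ≠ 0) {ε : ℝ} (hε : 0 < ε) :
    ∃ C, 0 ≤ C ∧ ∀ f : EuclideanSpace ℝ (Fin n) → ℝ, ContDiff ℝ ∞ f →
      ∫ x, (∑ i, pd i f x ^ 2) * ψ x ^ (2 * j + 2) ≤
        ε * (∫ x, lap f x ^ 2 * ψ x ^ (2 * j + 4)) + C * ∫ x, f x ^ 2 * ψ x ^ (2 * j) := by
  have hgc : Continuous fun x => ∑ i, pd i ψ x ^ 2 :=
    continuous_finsetSum _ fun i _ => (hψ.pd i).continuous.pow 2
  obtain ⟨M, hM⟩ := hc.isCompact.exists_bound_of_continuousOn hgc.continuousOn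
  have hM' : ∀ x, ψ x ≠ 0 → ∑ i, pd i ψ x ^ 2 ≤ |M| := fun x hx =>
    (le_abs_self _).trans ((hM x (subset_tsupport _ hx)).trans (le_abs_self M))
  refine ⟨ε⁻¹ + (2 * (j + 1)) ^ 2 * |M|, by positivity, fun f hf => ?_⟩
  have hX : ∀ i, ContDiff ℝ ∞ fun x => (f x * pd i f x) * ψ x ^ (2 * j + 1 + 1) :=
    fun i => (hf.mul (hf.pd i)).mul (hψ.pow _)
  have hXc : ∀ i, HasCompactSupport fun x => (f x * pd i f x) * ψ x ^ (2 * j + 1 + 1) :=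
    fun i => HasCompactSupport.intro hc fun x hx => by
      simp [image_eq_zero_of_notMem_tsupport hx]
  have hXi : ∀ i ∈ Finset.univ, Integrable
      (pd i fun x => (f x * pd i f x) * ψ x ^ (2 * j + 1 + 1)) := fun i _ =>
    ((hX i).pd i).continuous.integrable_of_hasCompactSupport ((hXc i).pd i)
  have hdiv : ∫ x, ∑ i, pd i (fun x => (f x * pd i f x) * ψ x ^ (2 * j + 1 + 1)) x = 0 := by
    rw [integral_finsetSum _ hXi]
    exact Finset.sum_eq_zero fun i _ => integral_pd_eq_zero (hX i) (hXc i) i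
  have hpt : ∀ x, (∑ i, pd i f x ^ 2) * ψ x ^ (2 * j + 2) ≤
      2 * (∑ i, pd i (fun x => (f x * pd i f x) * ψ x ^ (2 * j + 1 + 1)) x) +
        (ε * (lap f x ^ 2 * ψ x ^ (2 * j + 4)) +
          (ε⁻¹ + (2 * (j + 1)) ^ 2 * |M|) * (f x ^ 2 * ψ x ^ (2 * j))) := by
    intro x
    have hexp : ∑ i, pd i (fun x => (f x * pd i f x) * ψ x ^ (2 * j + 1 + 1)) x =
        ψ x ^ (2 * j) * (ψ x ^ 2 * (∑ i, pd i f x ^ 2) + ψ x ^ 2 * (f x * lap f x) +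
          (2 * j + 2) * ψ x * f x * ∑ i, pd i f x * pd i ψ x) := by
      rw [lap_eq_sum_pd hf]
      simp only [Finset.mul_sum, ← Finset.sum_add_distrib]
      refine Finset.sum_congr rfl fun i _ => ?_
      rw [pd_mul (hf.mul (hf.pd i)) (hψ.pow _), pd_mul hf (hf.pd i), pd_pow hψ]
      push_cast
      ring
    rw [hexp]
    by_cases hx : ψ x = 0
    · simp [hx, hj]
    have hP : 0 ≤ ψ x ^ (2 * j) := (even_two_mul j).pow_nonneg _
    have h1 : 0 ≤ ε * (lap f x * ψ x ^ 2) ^ 2 + 2 * f x * (lap f x * ψ x ^ 2) +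
        ε⁻¹ * f x ^ 2 := by
      have : ε * (lap f x * ψ x ^ 2) ^ 2 + 2 * f x * (lap f x * ψ x ^ 2) + ε⁻¹ * f x ^ 2 =
          ε * (lap f x * ψ x ^ 2 + ε⁻¹ * f x) ^ 2 := by
        field_simp
        ring
      rw [this]
      positivity
    have h2 : 0 ≤ ψ x ^ 2 * (∑ i, pd i f x ^ 2) +
        2 * ((2 * j + 2) * ψ x * f x * ∑ i, pd i f x * pd i ψ x) +
        (2 * (j + 1)) ^ 2 * f x ^ 2 * ∑ i, pd i ψ x ^ 2 := by
      simp only [Finset.mul_sum, ← Finset.sum_add_distrib]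
      refine Finset.sum_nonneg fun i _ => ?_
      nlinarith [sq_nonneg (ψ x * pd i f x + 2 * (j + 1) * f x * pd i ψ x)]
    have h3 : (2 * (j + 1)) ^ 2 * f x ^ 2 * ∑ i, pd i ψ x ^ 2 ≤
        (2 * ((j : ℝ) + 1)) ^ 2 * f x ^ 2 * |M| :=
      mul_le_mul_of_nonneg_left (hM' x hx) (by positivity)
    have h4 := mul_nonneg hP (add_nonneg h1 (h2.trans (add_le_add_right h3 _)))
    rw [← sub_nonneg]
    refine h4.trans_eq ?_
    ring
  have hI1 : Integrable fun x => (∑ i, pd i f x ^ 2) * ψ x ^ (2 * j + 2) :=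
    integrable_mul_pow hψ hc (by omega)
      (continuous_finsetSum _ fun i _ => (hf.pd i).continuous.pow 2)
  have hI2 : Integrable fun x => lap f x ^ 2 * ψ x ^ (2 * j + 4) :=
    integrable_mul_pow hψ hc (by omega) (hf.lap.continuous.pow 2)
  have hI3 : Integrable fun x => f x ^ 2 * ψ x ^ (2 * j) :=
    integrable_mul_pow hψ hc (by omega) (hf.continuous.pow 2)
  have hI4 := integrable_finsetSum _ hXi
  refine (integral_mono hI1
    ((hI4.const_mul 2).add ((hI2.const_mul ε).add (hI3.const_mul _))) hpt).trans_eq ?_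
  rw [integral_add' (hI4.const_mul 2) ((hI2.const_mul ε).add (hI3.const_mul _)),
    integral_add' (hI2.const_mul ε) (hI3.const_mul _)]
  simp only [integral_const_mul]
  rw [hdiv]
  ring

end Cutoff

section Jet

variable {n : ℕ}

/-- Weighted sum of absolute values of the derivatives of `v` of order at most three. -/
noncomputable def jetNorm (ψ v : EuclideanSpace ℝ (Fin n) → ℝ)
    (x : EuclideanSpace ℝ (Fin n)) : ℝ :=
  |v x| + (∑ i, |pd i v x|) * ψ x + (|lap v x| + ∑ i, ∑ j, |pd j (pd i v) x|) * ψ x ^ 2 +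
    (∑ i, |pd i (lap v) x|) * ψ x ^ 3

/-- Weighted sum of squares of the derivatives of `v` of order at most three. -/
noncomputable def jetEnergy (ψ : EuclideanSpace ℝ (Fin n) → ℝ) (k : ℕ)
    (v : EuclideanSpace ℝ (Fin n) → ℝ) (x : EuclideanSpace ℝ (Fin n)) : ℝ :=
  v x ^ 2 * ψ x ^ (2 * k) + (∑ i, pd i v x ^ 2) * ψ x ^ (2 * k + 2) +
    (lap v x ^ 2 * ψ x ^ (2 * k + 4) + (∑ i, ∑ j, pd j (pd i v) x ^ 2) * ψ x ^ (2 * k + 4)) +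
    (∑ i, pd i (lap v) x ^ 2) * ψ x ^ (2 * k + 6)

variable {ψ : EuclideanSpace ℝ (Fin n) → ℝ}

lemma jetNorm_sq_le (k : ℕ) (v : EuclideanSpace ℝ (Fin n) → ℝ)
    (x : EuclideanSpace ℝ (Fin n)) :
    ψ x ^ (2 * k) * jetNorm ψ v x ^ 2 ≤ 5 * (1 + (n : ℝ)) ^ 2 * jetEnergy ψ k v x := by
  have hP : 0 ≤ ψ x ^ (2 * k) := (even_two_mul k).pow_nonneg _
  have hn : (0 : ℝ) ≤ n := Nat.cast_nonneg n
  have hsum : ∀ F : Fin n → ℝ, (∑ i, |F i|) ^ 2 ≤ n * ∑ i, F i ^ 2 := fun F => by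
    simpa using sq_sum_le_card_mul_sum_sq (s := Finset.univ) (f := fun i => |F i|)
  have hle : ∀ {a b c : ℝ}, 0 ≤ b → c ≤ (1 + (n : ℝ)) ^ 2 → a ≤ c * b →
      a ≤ (1 + (n : ℝ)) ^ 2 * b := fun hb hc h => h.trans (mul_le_mul_of_nonneg_right hc hb)
  have hc1 : (n : ℝ) ≤ (1 + (n : ℝ)) ^ 2 := by nlinarith
  have hb := hle (Finset.sum_nonneg fun i _ => sq_nonneg (pd i v x)) hc1 (hsum _)
  have he := hle (Finset.sum_nonneg fun i _ => sq_nonneg (pd i (lap v) x)) hc1 (hsum _)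
  have hd : (∑ i, ∑ j, |pd j (pd i v) x|) ^ 2 ≤
      (1 + (n : ℝ)) ^ 2 * ∑ i, ∑ j, pd j (pd i v) x ^ 2 := by
    refine hle (Finset.sum_nonneg fun i _ => Finset.sum_nonneg fun j _ => sq_nonneg _)
      (c := (n : ℝ) * n) (by nlinarith) ?_
    have h := sq_sum_le_card_mul_sum_sq (s := Finset.univ)
      (f := fun i => ∑ j, |pd j (pd i v) x|)
    rw [Finset.card_univ, Fintype.card_fin] at h
    refine h.trans ?_
    rw [mul_assoc]
    refine mul_le_mul_of_nonneg_left ?_ hn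
    rw [Finset.mul_sum]
    exact Finset.sum_le_sum fun i _ => hsum _
  have ha : |v x| ^ 2 ≤ (1 + (n : ℝ)) ^ 2 * v x ^ 2 := by
    rw [sq_abs]
    nlinarith [sq_nonneg (v x), mul_nonneg hn (sq_nonneg (v x)), mul_nonneg hn hn,
      mul_nonneg (mul_nonneg hn hn) (sq_nonneg (v x))]
  have hl : |lap v x| ^ 2 ≤ (1 + (n : ℝ)) ^ 2 * lap v x ^ 2 := by
    rw [sq_abs]
    nlinarith [sq_nonneg (lap v x), mul_nonneg hn (sq_nonneg (lap v x)), mul_nonneg hn hn,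
      mul_nonneg (mul_nonneg hn hn) (sq_nonneg (lap v x))]
  have h5 : ∀ a b c d e : ℝ,
      (a + b + (c + d) + e) ^ 2 ≤ 5 * (a ^ 2 + b ^ 2 + (c ^ 2 + d ^ 2) + e ^ 2) := by
    intro a b c d e
    nlinarith [sq_nonneg (a - b), sq_nonneg (a - c), sq_nonneg (a - d), sq_nonneg (a - e),
      sq_nonneg (b - c), sq_nonneg (b - d), sq_nonneg (b - e), sq_nonneg (c - d),
      sq_nonneg (c - e), sq_nonneg (d - e)]
  have h := h5 |v x| ((∑ i, |pd i v x|) * ψ x) (|lap v x| * ψ x ^ 2)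
    ((∑ i, ∑ j, |pd j (pd i v) x|) * ψ x ^ 2) ((∑ i, |pd i (lap v) x|) * ψ x ^ 3)
  have hN : jetNorm ψ v x ^ 2 ≤ 5 * ((1 + (n : ℝ)) ^ 2 * v x ^ 2 +
      ((1 + (n : ℝ)) ^ 2 * ∑ i, pd i v x ^ 2) * ψ x ^ 2 +
      (((1 + (n : ℝ)) ^ 2 * lap v x ^ 2) * ψ x ^ 4 +
        ((1 + (n : ℝ)) ^ 2 * ∑ i, ∑ j, pd j (pd i v) x ^ 2) * ψ x ^ 4) +
      ((1 + (n : ℝ)) ^ 2 * ∑ i, pd i (lap v) x ^ 2) * ψ x ^ 6) := by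
    have h4 : (0 : ℝ) ≤ ψ x ^ 4 := by positivity
    have h6 : (0 : ℝ) ≤ ψ x ^ 6 := by positivity
    have k1 := mul_le_mul_of_nonneg_right hb (sq_nonneg (ψ x))
    have k2 := mul_le_mul_of_nonneg_right hl h4
    have k3 := mul_le_mul_of_nonneg_right hd h4
    have k4 := mul_le_mul_of_nonneg_right he h6
    have e : jetNorm ψ v x = |v x| + (∑ i, |pd i v x|) * ψ x + (|lap v x| * ψ x ^ 2 +
        (∑ i, ∑ j, |pd j (pd i v) x|) * ψ x ^ 2) + (∑ i, |pd i (lap v) x|) * ψ x ^ 3 := by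
      rw [jetNorm]
      ring
    rw [e]
    refine h.trans ?_
    simp only [mul_pow, ← pow_mul]
    norm_num only at k1 k2 k3 k4 ⊢
    linarith
  refine (mul_le_mul_of_nonneg_left hN hP).trans_eq ?_
  rw [jetEnergy]
  ring

lemma exists_commutator_bound (hψ : ContDiff ℝ ∞ ψ) (hψ0 : ∀ x, 0 ≤ ψ x)
    (hc : HasCompactSupport ψ) {q : ℕ} (hq : q ≠ 0)
    {ζ : EuclideanSpace ℝ (Fin n) → ℝ} (hζ : HasOrder ψ (q + 4) ζ) :
    ∃ C, 0 ≤ C ∧ ∀ v : EuclideanSpace ℝ (Fin n) → ℝ, ContDiff ℝ ∞ v → ∀ x,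
      |lap (lap fun x => v x * ζ x) x - ζ x * lap (lap v) x| ≤
        C * (ψ x ^ q * jetNorm ψ v x) := by
  have hζc := hζ.contDiff hψ
  obtain ⟨C1, h1⟩ := HasOrder.exists_bound_family hψ0 hc (Nat.succ_ne_zero _)
    fun i : Fin n => hζ.pd hψ i
  obtain ⟨C2, h2⟩ := HasOrder.exists_bound_family hψ0 hc (Nat.succ_ne_zero _)
    fun ij : Fin n × Fin n => (hζ.pd hψ ij.1).pd hψ ij.2
  obtain ⟨C2', h2'⟩ := (HasOrder.lap (q := q + 2) hψ hζ).exists_bound hψ0 hc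
    (Nat.succ_ne_zero _)
  obtain ⟨C3, h3⟩ := HasOrder.exists_bound_family hψ0 hc (Nat.succ_ne_zero _)
    fun i : Fin n => (HasOrder.lap (q := q + 2) hψ hζ).pd hψ i
  obtain ⟨C4, h4⟩ := (HasOrder.lap hψ (HasOrder.lap (q := q + 2) hψ hζ)).exists_bound hψ0 hc hq
  set C := |C1| + |C2| + |C2'| + |C3| + |C4| with hCdef
  have hC : 0 ≤ C := by positivity
  have up : ∀ {a c : ℝ} {m : ℕ} {x}, a ≤ c * ψ x ^ m → c ≤ C → a ≤ C * ψ x ^ m :=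
    fun h hcC => h.trans (mul_le_mul_of_nonneg_right hcC (pow_nonneg (hψ0 _) _))
  have g1 := abs_nonneg C1
  have g2 := abs_nonneg C2
  have g3 := abs_nonneg C2'
  have g4 := abs_nonneg C3
  have g5 := abs_nonneg C4
  have hC1 : C1 ≤ C := by linarith [le_abs_self C1]
  have hC2 : C2 ≤ C := by linarith [le_abs_self C2]
  have hC2' : C2' ≤ C := by linarith [le_abs_self C2']
  have hC3 : C3 ≤ C := by linarith [le_abs_self C3]
  have hC4 : C4 ≤ C := by linarith [le_abs_self C4]
  have hmul : ∀ {a b c : ℝ}, |b| ≤ c → |a * b| ≤ |a| * c := fun h => by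
    rw [abs_mul]
    exact mul_le_mul_of_nonneg_left h (abs_nonneg _)
  refine ⟨4 * C, by positivity, fun v hv x => ?_⟩
  have t0 : |v x * lap (lap ζ) x| ≤ |v x| * (C * ψ x ^ q) := hmul (up (h4 x) hC4)
  have t1 : |∑ i, pd i v x * pd i (lap ζ) x| ≤ (∑ i, |pd i v x|) * (C * ψ x ^ (q + 1)) := by
    rw [Finset.sum_mul]
    exact (Finset.abs_sum_le_sum_abs _ _).trans
      (Finset.sum_le_sum fun i _ => hmul (up (h3 i x) hC3))
  have t2 : |lap v x * lap ζ x| ≤ |lap v x| * (C * ψ x ^ (q + 2)) := hmul (up (h2' x) hC2')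
  have t2' : |∑ i, ∑ j, pd j (pd i v) x * pd j (pd i ζ) x| ≤
      (∑ i, ∑ j, |pd j (pd i v) x|) * (C * ψ x ^ (q + 2)) := by
    simp only [Finset.sum_mul]
    refine (Finset.abs_sum_le_sum_abs _ _).trans (Finset.sum_le_sum fun i _ => ?_)
    exact (Finset.abs_sum_le_sum_abs _ _).trans
      (Finset.sum_le_sum fun j _ => hmul (up (h2 (i, j) x) hC2))
  have t3 : |∑ i, pd i (lap v) x * pd i ζ x| ≤
      (∑ i, |pd i (lap v) x|) * (C * ψ x ^ (q + 3)) := by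
    rw [Finset.sum_mul]
    exact (Finset.abs_sum_le_sum_abs _ _).trans
      (Finset.sum_le_sum fun i _ => hmul (up (h1 i x) hC1))
  have n0 := (abs_nonneg _).trans t0
  have n2 := (abs_nonneg _).trans t2
  have e : 4 * C * (ψ x ^ q * jetNorm ψ v x) = 4 * (|v x| * (C * ψ x ^ q) +
      (∑ i, |pd i v x|) * (C * ψ x ^ (q + 1)) + |lap v x| * (C * ψ x ^ (q + 2)) +
      (∑ i, ∑ j, |pd j (pd i v) x|) * (C * ψ x ^ (q + 2)) +
      (∑ i, |pd i (lap v) x|) * (C * ψ x ^ (q + 3))) := by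
    rw [jetNorm]
    ring
  rw [e, lap_lap_mul hv hζc]
  rw [abs_le] at t0 t1 t2 t2' t3 ⊢
  constructor <;> linarith [t0.1, t0.2, t1.1, t1.2, t2.1, t2.2, t2'.1, t2'.2, t3.1, t3.2]

lemma sum_le_of_interpolation {N : ℝ} (hN : 1 ≤ N) {δ C3 C2 C1 ε1 ε2 A0 A1 A2 AH A3 A4 : ℝ}
    (hC3 : 0 ≤ C3) (hC2 : 0 ≤ C2) (hA2 : 0 ≤ A2) (hA3 : 0 ≤ A3)
    (hε2 : ε2 = 1 / (4 * N * (1 + C3))) (hε1 : ε1 = 1 / (2 * N * (1 + C2)))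
    (h3 : A3 ≤ δ / 10 * A4 + C3 * A2) (hH : AH ≤ ε2 * A3 + C2 * A1) (h2 : A2 ≤ N * AH)
    (h1 : A1 ≤ ε1 * A2 + C1 * A0) :
    A0 + A1 + (A2 + AH) + A3 ≤ δ * A4 +
      (1 + C1 + C1 * C2 + 6 * N * C1 * C2 + 20 * N * C1 * C2 * C3) * A0 := by
  have hN0 : 0 < N := by linarith
  have e1 : N * C2 * ε1 ≤ 1 / 2 := by
    rw [hε1, mul_one_div, div_le_iff₀ (by positivity)]
    nlinarith
  have e1' : C2 * ε1 ≤ 1 := by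
    rw [hε1, mul_one_div, div_le_iff₀ (by positivity)]
    nlinarith
  have e1'' : ε1 ≤ 1 := by
    rw [hε1, div_le_iff₀ (by positivity)]
    nlinarith
  have e2 : N * ε2 * C3 ≤ 1 / 4 := by
    rw [hε2, mul_one_div, div_mul_eq_mul_div, div_le_iff₀ (by positivity)]
    nlinarith
  have e2' : N * ε2 ≤ 1 / 2 := by
    rw [hε2, mul_one_div, div_le_iff₀ (by positivity)]
    nlinarith
  have e2'' : ε2 ≤ 1 := by
    rw [hε2, div_le_iff₀ (by positivity)]
    nlinarith
  have b2 : A2 ≤ 2 * (N * ε2) * A3 + 2 * N * C1 * C2 * A0 := by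
    have := mul_le_mul_of_nonneg_left hH hN0.le
    have := mul_le_mul_of_nonneg_left h1 (mul_nonneg hN0.le hC2)
    have := mul_le_mul_of_nonneg_right e1 hA2
    linarith
  have b3 : A3 ≤ δ / 5 * A4 + 4 * N * C1 * C2 * C3 * A0 := by
    have := mul_le_mul_of_nonneg_left b2 hC3
    have := mul_le_mul_of_nonneg_right e2 hA3
    linarith
  have b2' : A2 ≤ A3 + 2 * N * C1 * C2 * A0 := by
    have := mul_le_mul_of_nonneg_right e2' hA3
    linarith
  have b1 : A1 ≤ A2 + C1 * A0 := by
    have := mul_le_mul_of_nonneg_right e1'' hA2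
    linarith
  have bH : AH ≤ A3 + A2 + C1 * C2 * A0 := by
    have := mul_le_mul_of_nonneg_right e2'' hA3
    have := mul_le_mul_of_nonneg_left h1 hC2
    have := mul_le_mul_of_nonneg_right e1' hA2
    linarith
  linarith

lemma lap_sq_le (v : EuclideanSpace ℝ (Fin n) → ℝ) (hv : ContDiff ℝ ∞ v)
    (x : EuclideanSpace ℝ (Fin n)) :
    lap v x ^ 2 ≤ (1 + (n : ℝ)) * ∑ i, ∑ j, pd j (pd i v) x ^ 2 := by
  rw [lap_eq_sum_pd hv]
  have h := sq_sum_le_card_mul_sum_sq (s := Finset.univ) (f := fun i => pd i (pd i v) x)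
  rw [Finset.card_univ, Fintype.card_fin] at h
  refine h.trans (mul_le_mul (by linarith) (Finset.sum_le_sum fun i _ => ?_)
    (Finset.sum_nonneg fun i _ => sq_nonneg _) (by positivity))
  exact Finset.single_le_sum (f := fun j => pd j (pd i v) x ^ 2)
    (fun _ _ => sq_nonneg _) (Finset.mem_univ i)

lemma integrable_jetEnergy_terms (hψ : ContDiff ℝ ∞ ψ) (hc : HasCompactSupport ψ) {k : ℕ}
    (hk : k ≠ 0) {v : EuclideanSpace ℝ (Fin n) → ℝ} (hv : ContDiff ℝ ∞ v) :
    Integrable (fun x => v x ^ 2 * ψ x ^ (2 * k)) ∧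
    Integrable (fun x => (∑ i, pd i v x ^ 2) * ψ x ^ (2 * k + 2)) ∧
    Integrable (fun x => lap v x ^ 2 * ψ x ^ (2 * k + 4)) ∧
    Integrable (fun x => (∑ i, ∑ j, pd j (pd i v) x ^ 2) * ψ x ^ (2 * k + 4)) ∧
    Integrable (fun x => (∑ i, pd i (lap v) x ^ 2) * ψ x ^ (2 * k + 6)) :=
  ⟨integrable_mul_pow hψ hc (by omega) (hv.continuous.pow 2),
    integrable_mul_pow hψ hc (by omega)
      (continuous_finsetSum _ fun i _ => (hv.pd i).continuous.pow 2),
    integrable_mul_pow hψ hc (by omega) (hv.lap.continuous.pow 2),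
    integrable_mul_pow hψ hc (by omega)
      (continuous_finsetSum _ fun i _ => continuous_finsetSum _ fun j _ =>
        ((hv.pd i).pd j).continuous.pow 2),
    integrable_mul_pow hψ hc (by omega)
      (continuous_finsetSum _ fun i _ => (hv.lap.pd i).continuous.pow 2)⟩

lemma integrable_jetEnergy (hψ : ContDiff ℝ ∞ ψ) (hc : HasCompactSupport ψ) {k : ℕ}
    (hk : k ≠ 0) {v : EuclideanSpace ℝ (Fin n) → ℝ} (hv : ContDiff ℝ ∞ v) :
    Integrable (jetEnergy ψ k v) := by
  obtain ⟨i0, i1, i2, iH, i3⟩ := integrable_jetEnergy_terms hψ hc hk hv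
  exact ((i0.add i1).add (i2.add iH)).add i3

lemma exists_integral_jetEnergy_le (hψ : ContDiff ℝ ∞ ψ) (hc : HasCompactSupport ψ)
    {k : ℕ} (hk : k ≠ 0) {δ : ℝ} (hδ : 0 < δ) :
    ∃ C, 0 ≤ C ∧ ∀ v : EuclideanSpace ℝ (Fin n) → ℝ, ContDiff ℝ ∞ v →
      ∫ x, jetEnergy ψ k v x ≤
        δ * (∫ x, lap (lap v) x ^ 2 * ψ x ^ (2 * k + 8)) + C * ∫ x, v x ^ 2 * ψ x ^ (2 * k) := by
  obtain ⟨C3, hC3, h3⟩ := exists_integral_grad_sq_le hψ hc (j := k + 2) (by omega)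
    (show 0 < δ / 10 by positivity)
  obtain ⟨C2, hC2, h2⟩ := exists_integral_grad_sq_le hψ hc (j := k + 1) (by omega)
    (show 0 < 1 / (4 * (1 + (n : ℝ)) * (1 + C3)) by positivity)
  obtain ⟨C1, hC1, h1⟩ := exists_integral_grad_sq_le hψ hc (j := k) hk
    (show 0 < 1 / (2 * (1 + (n : ℝ)) * (1 + C2)) by positivity)
  refine ⟨1 + C1 + C1 * C2 + 6 * (1 + (n : ℝ)) * C1 * C2 + 20 * (1 + (n : ℝ)) * C1 * C2 * C3,
    by positivity, fun v hv => ?_⟩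
  obtain ⟨i0, i1, i2, iH, i3⟩ := integrable_jetEnergy_terms hψ hc hk hv
  have hI : ∫ x, jetEnergy ψ k v x = (∫ x, v x ^ 2 * ψ x ^ (2 * k)) +
      (∫ x, (∑ i, pd i v x ^ 2) * ψ x ^ (2 * k + 2)) +
      ((∫ x, lap v x ^ 2 * ψ x ^ (2 * k + 4)) +
        ∫ x, (∑ i, ∑ j, pd j (pd i v) x ^ 2) * ψ x ^ (2 * k + 4)) +
      ∫ x, (∑ i, pd i (lap v) x ^ 2) * ψ x ^ (2 * k + 6) := by
    have h := integral_add' ((i0.add i1).add (i2.add iH)) i3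
    rw [integral_add' (i0.add i1) (i2.add iH), integral_add' i0 i1, integral_add' i2 iH] at h
    exact h
  rw [hI]
  have hev : ∀ {m : ℕ} (x : EuclideanSpace ℝ (Fin n)), Even m → 0 ≤ ψ x ^ m :=
    fun x hm => hm.pow_nonneg _
  refine sum_le_of_interpolation (N := 1 + (n : ℝ)) (by simp) hC3 hC2 ?_ ?_ rfl rfl
    (h3 _ hv.lap) ?_ ?_ (h1 v hv)
  · exact integral_nonneg fun x => mul_nonneg (sq_nonneg _) (hev x ⟨k + 2, by ring⟩)
  · exact integral_nonneg fun x => mul_nonneg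
      (Finset.sum_nonneg fun i _ => sq_nonneg _) (hev x ⟨k + 3, by ring⟩)
  · have hs := Finset.sum_le_sum fun (i : Fin n) (_ : i ∈ Finset.univ) => h2 _ (hv.pd i)
    rw [Finset.sum_add_distrib, ← Finset.mul_sum, ← Finset.mul_sum,
      ← integral_finsetSum, ← integral_finsetSum, ← integral_finsetSum] at hs
    · simp only [← Finset.sum_mul, ← pd_lap hv] at hs
      exact hs
    · exact fun i _ => integrable_mul_pow hψ hc (by omega) ((hv.pd i).continuous.pow 2)
    · exact fun i _ => integrable_mul_pow hψ hc (by omega) ((hv.pd i).lap.continuous.pow 2)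
    · exact fun i _ => integrable_mul_pow hψ hc (by omega)
        (continuous_finsetSum _ fun j _ => ((hv.pd i).pd j).continuous.pow 2)
  · rw [← integral_const_mul]
    refine integral_mono i2 (iH.const_mul _) fun x => ?_
    have := mul_le_mul_of_nonneg_right (lap_sq_le v hv x) (hev (m := 2 * k + 4) x ⟨k + 2, by ring⟩)
    simpa only [mul_assoc] using this

end Jet

section Energy

variable {n : ℕ} {ψ : EuclideanSpace ℝ (Fin n) → ℝ}

lemma exists_weighted_energy_le (hψ : ContDiff ℝ ∞ ψ) (hψ0 : ∀ x, 0 ≤ ψ x)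
    (hc : HasCompactSupport ψ) {k : ℕ} (hk : k ≠ 0) {p : ℝ} (hp : 1 < p) :
    ∃ C, 0 ≤ C ∧ ∀ v V : EuclideanSpace ℝ (Fin n) → ℝ, ContDiff ℝ ∞ v →
      (∀ x, lap (lap (lap (lap v))) x = V x * v x) →
      (∀ φ : EuclideanSpace ℝ (Fin n) → ℝ, ContDiff ℝ ∞ φ → HasCompactSupport φ →
        p * ∫ x, V x * φ x ^ 2 ≤ ∫ x, lap (lap φ) x ^ 2) →
      (∫ x, V x * v x ^ 2 * ψ x ^ (2 * k + 8)) + ∫ x, lap (lap v) x ^ 2 * ψ x ^ (2 * k + 8) ≤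
        C * ∫ x, v x ^ 2 * ψ x ^ (2 * k) := by
  obtain ⟨C1, hC1, h1⟩ := exists_commutator_bound hψ hψ0 hc hk (hasOrder_pow (k + 4))
  obtain ⟨C2, hC2, h2⟩ := exists_commutator_bound hψ hψ0 hc (q := 2 * k + 4) (by omega)
    (hasOrder_pow (2 * k + 4 + 4))
  set K : ℝ := 5 * (1 + (n : ℝ)) ^ 2 with hK
  have hK0 : 0 ≤ K := by positivity
  set ε : ℝ := (p - 1) / (4 * (p + 1)) with hεdef
  have hε : 0 < ε := div_pos (by linarith) (by linarith)
  have hεp : 4 * (p + 1) * ε = p - 1 := by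
    rw [hεdef]
    field_simp
  set B : ℝ := ((1 + ε⁻¹) * C1 ^ 2 + ε⁻¹ * C2 ^ 2) * K with hB
  have hB0 : 0 ≤ B := by positivity
  obtain ⟨C3, hC3, h3⟩ := exists_integral_jetEnergy_le hψ hc hk (δ := ε / (B + 1))
    (by positivity)
  set D : ℝ := 2 * (p + 1) / (p - 1) * (B * C3) with hD
  have hp1 : 0 < p - 1 := by linarith
  refine ⟨D + ((1 + 2 * ε) * D + B * C3) / p, by positivity, fun v V hv heq hst => ?_⟩
  set L := lap (lap v) with hL
  have hLs : ContDiff ℝ ∞ L := hv.lap.lap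
  have hφ : ContDiff ℝ ∞ fun x => v x * ψ x ^ (k + 4) := hv.mul (hψ.pow _)
  have hφc : HasCompactSupport fun x => v x * ψ x ^ (k + 4) :=
    HasCompactSupport.intro hc fun x hx => by simp [image_eq_zero_of_notMem_tsupport hx]
  have hχ : ContDiff ℝ ∞ fun x => v x * ψ x ^ (2 * k + 4 + 4) := hv.mul (hψ.pow _)
  have hχc : HasCompactSupport fun x => v x * ψ x ^ (2 * k + 4 + 4) :=
    HasCompactSupport.intro hc fun x hx => by simp [image_eq_zero_of_notMem_tsupport hx]
  have iL : Integrable fun x => L x ^ 2 * ψ x ^ (2 * k + 8) :=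
    integrable_mul_pow hψ hc (by omega) (hLs.continuous.pow 2)
  have iJ := integrable_jetEnergy hψ hc hk hv
  have hNT : ∀ x, ψ x ^ (2 * k) * jetNorm ψ v x ^ 2 ≤ K * jetEnergy ψ k v x :=
    jetNorm_sq_le k v
  have hT0 : ∀ x, 0 ≤ K * jetEnergy ψ k v x := fun x =>
    (mul_nonneg ((even_two_mul k).pow_nonneg _) (sq_nonneg _)).trans (hNT x)
  have q1 : ∀ x, lap (lap fun x => v x * ψ x ^ (k + 4)) x ^ 2 ≤
      (1 + ε) * (L x ^ 2 * ψ x ^ (2 * k + 8)) + B * jetEnergy ψ k v x := by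
    intro x
    set X := lap (lap fun x => v x * ψ x ^ (k + 4)) x
    set Y := ψ x ^ (k + 4) * L x with hY
    have e1 : (X - Y) ^ 2 ≤ C1 ^ 2 * (K * jetEnergy ψ k v x) := by
      have := pow_le_pow_left₀ (abs_nonneg _) (h1 v hv x) 2
      rw [sq_abs] at this
      refine this.trans ?_
      calc (C1 * (ψ x ^ k * jetNorm ψ v x)) ^ 2
          = C1 ^ 2 * (ψ x ^ (2 * k) * jetNorm ψ v x ^ 2) := by ring
        _ ≤ _ := mul_le_mul_of_nonneg_left (hNT x) (sq_nonneg _)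
    have e2 : X ^ 2 ≤ (1 + ε) * Y ^ 2 + (1 + ε⁻¹) * (X - Y) ^ 2 := by
      have : (1 + ε) * Y ^ 2 + (1 + ε⁻¹) * (X - Y) ^ 2 - X ^ 2 =
          ε * (Y - ε⁻¹ * (X - Y)) ^ 2 := by
        field_simp
        ring
      nlinarith [mul_nonneg hε.le (sq_nonneg (Y - ε⁻¹ * (X - Y)))]
    have e3 : Y ^ 2 = L x ^ 2 * ψ x ^ (2 * k + 8) := by
      rw [hY]
      ring
    have e4 := mul_le_mul_of_nonneg_left e1 (show 0 ≤ 1 + ε⁻¹ by positivity)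
    have e5 : 0 ≤ ε⁻¹ * C2 ^ 2 * (K * jetEnergy ψ k v x) := mul_nonneg (by positivity) (hT0 x)
    rw [e3] at e2
    rw [hB]
    linarith
  have q2 : ∀ x, (1 - ε) * (L x ^ 2 * ψ x ^ (2 * k + 8)) - B * jetEnergy ψ k v x ≤
      L x * lap (lap fun x => v x * ψ x ^ (2 * k + 4 + 4)) x := by
    intro x
    set X := lap (lap fun x => v x * ψ x ^ (2 * k + 4 + 4)) x
    set F := X - ψ x ^ (2 * k + 4 + 4) * L x with hF
    have e1 : |L x * F| ≤ (|L x| * ψ x ^ (k + 4)) * (C2 * (ψ x ^ k * jetNorm ψ v x)) := by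
      rw [abs_mul]
      refine (mul_le_mul_of_nonneg_left (h2 v hv x) (abs_nonneg _)).trans_eq ?_
      ring
    have e2 : ∀ a b : ℝ, a * b ≤ ε * a ^ 2 + ε⁻¹ * b ^ 2 := fun a b => by
      have : ε * a ^ 2 + ε⁻¹ * b ^ 2 - a * b =
          ε * (a - ε⁻¹ * b / 2) ^ 2 + 3 / 4 * ε⁻¹ * b ^ 2 := by
        field_simp
        ring
      have : 0 ≤ ε * (a - ε⁻¹ * b / 2) ^ 2 + 3 / 4 * ε⁻¹ * b ^ 2 := by positivity
      linarith
    have e3 := e1.trans (e2 _ _)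
    have e4 : (|L x| * ψ x ^ (k + 4)) ^ 2 = L x ^ 2 * ψ x ^ (2 * k + 8) := by
      rw [mul_pow, sq_abs]
      ring
    have e5 : (C2 * (ψ x ^ k * jetNorm ψ v x)) ^ 2 ≤ C2 ^ 2 * (K * jetEnergy ψ k v x) := by
      calc (C2 * (ψ x ^ k * jetNorm ψ v x)) ^ 2
          = C2 ^ 2 * (ψ x ^ (2 * k) * jetNorm ψ v x ^ 2) := by ring
        _ ≤ _ := mul_le_mul_of_nonneg_left (hNT x) (sq_nonneg _)
    have e6 := mul_le_mul_of_nonneg_left e5 (inv_nonneg.2 hε.le)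
    have e7 : 0 ≤ (1 + ε⁻¹) * C1 ^ 2 * (K * jetEnergy ψ k v x) :=
      mul_nonneg (by positivity) (hT0 x)
    have e8 : L x * X = L x ^ 2 * ψ x ^ (2 * k + 8) + L x * F := by
      rw [hF]
      ring
    have e9 := neg_abs_le (L x * F)
    rw [e4] at e3
    rw [e8, hB]
    linarith
  set a := ∫ x, L x ^ 2 * ψ x ^ (2 * k + 8) with ha
  set P := ∫ x, V x * v x ^ 2 * ψ x ^ (2 * k + 8) with hP
  set S := ∫ x, v x ^ 2 * ψ x ^ (2 * k) with hS
  have r1 : p * P ≤ (1 + ε) * a + B * ∫ x, jetEnergy ψ k v x := by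
    have hi : Integrable fun x => lap (lap fun x => v x * ψ x ^ (k + 4)) x ^ 2 := by
      have hs : HasCompactSupport (lap (lap fun x => v x * ψ x ^ (k + 4))) :=
        HasCompactSupport.lap hφ.lap (HasCompactSupport.lap hφ hφc)
      refine (hφ.lap.lap.continuous.pow 2).integrable_of_hasCompactSupport ?_
      exact HasCompactSupport.intro hs fun x hx => by
        simp [image_eq_zero_of_notMem_tsupport hx]
    have hm := integral_mono hi ((iL.const_mul (1 + ε)).add (iJ.const_mul B)) q1
    rw [integral_add' (iL.const_mul (1 + ε)) (iJ.const_mul B), integral_const_mul,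
      integral_const_mul] at hm
    refine le_trans (le_of_eq ?_) ((hst _ hφ hφc).trans hm)
    rw [hP]
    congr 2
    funext x
    ring
  have r2 : (1 - ε) * a - B * (∫ x, jetEnergy ψ k v x) ≤ P := by
    have hi : Integrable fun x => L x * lap (lap fun x => v x * ψ x ^ (2 * k + 4 + 4)) x := by
      have hs : HasCompactSupport (lap (lap fun x => v x * ψ x ^ (2 * k + 4 + 4))) :=
        HasCompactSupport.lap hχ.lap (HasCompactSupport.lap hχ hχc)
      exact (hLs.continuous.mul hχ.lap.lap.continuous).integrable_of_hasCompactSupport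
        hs.mul_left
    have hm := integral_mono ((iL.const_mul (1 - ε)).sub (iJ.const_mul B)) hi q2
    rw [integral_sub' (iL.const_mul (1 - ε)) (iJ.const_mul B), integral_const_mul,
      integral_const_mul] at hm
    refine hm.trans_eq ?_
    rw [← integral_lap_mul hLs hχ.lap (HasCompactSupport.lap hχ hχc),
      ← integral_lap_mul hLs.lap hχ hχc, hP]
    congr 1
    funext x
    rw [hL, heq x]
    ring
  have r3 : B * (∫ x, jetEnergy ψ k v x) ≤ ε * a + B * C3 * S := by
    have ha0 : 0 ≤ a := integral_nonneg fun x =>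
      mul_nonneg (sq_nonneg _) (pow_nonneg (hψ0 x) _)
    have hm := mul_le_mul_of_nonneg_left (h3 v hv) hB0
    have hle : B * (ε / (B + 1)) ≤ ε := by
      rw [mul_div_assoc', div_le_iff₀ (by positivity)]
      nlinarith
    have := mul_le_mul_of_nonneg_right hle ha0
    linarith
  have ra : a ≤ D * S := by
    have : (p - 1) * a ≤ 2 * (p + 1) * (B * C3 * S) := by
      have f1 := mul_le_mul_of_nonneg_left r2 (show 0 ≤ p by linarith)
      have f2 := mul_le_mul_of_nonneg_left r3 (show 0 ≤ 1 + p by linarith)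
      have f3 : 4 * (p + 1) * ε * a = (p - 1) * a := by rw [hεp]
      linarith
    rw [hD, show 2 * (p + 1) / (p - 1) * (B * C3) * S = 2 * (p + 1) * (B * C3 * S) / (p - 1) by
      ring, le_div_iff₀ hp1]
    linarith
  have rP : P ≤ ((1 + 2 * ε) * D + B * C3) / p * S := by
    rw [div_mul_eq_mul_div, le_div_iff₀ (by linarith)]
    have := mul_le_mul_of_nonneg_left ra (show 0 ≤ 1 + 2 * ε by positivity)
    linarith
  linarith

end Energy

section Scaling

variable {n : ℕ} {f : EuclideanSpace ℝ (Fin n) → ℝ}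

lemma contDiff_comp_smul (hf : ContDiff ℝ ∞ f) (R : ℝ) : ContDiff ℝ ∞ fun x => f (R • x) :=
  hf.comp (contDiff_const_smul R)

lemma pd_comp_smul (f : EuclideanSpace ℝ (Fin n) → ℝ) (R : ℝ) (i : Fin n) :
    pd i (fun x => f (R • x)) = fun x => R * pd i f (R • x) := by
  funext x
  simp only [pd]
  rw [fderiv_comp_smul]
  simp

lemma lap_comp_smul (hf : ContDiff ℝ ∞ f) (R : ℝ) :
    lap (fun x => f (R • x)) = fun x => R ^ 2 * lap f (R • x) := by
  rw [lap_eq_sum_pd (contDiff_comp_smul hf R), lap_eq_sum_pd hf]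
  funext x
  rw [Finset.mul_sum]
  refine Finset.sum_congr rfl fun i _ => ?_
  rw [pd_comp_smul, pd_const_mul (contDiff_comp_smul (hf.pd i) R), pd_comp_smul]
  ring

lemma lap_lap_comp_smul (hf : ContDiff ℝ ∞ f) (R : ℝ) :
    lap (lap fun x => f (R • x)) = fun x => R ^ 4 * lap (lap f) (R • x) := by
  rw [lap_comp_smul hf, lap_const_mul (contDiff_comp_smul hf.lap R), lap_comp_smul hf.lap]
  funext x
  ring

lemma stable_comp_smul {p : ℝ} {W : EuclideanSpace ℝ (Fin n) → ℝ}
    (hst : ∀ φ : EuclideanSpace ℝ (Fin n) → ℝ, ContDiff ℝ ∞ φ → HasCompactSupport φ →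
      p * ∫ x, W x * φ x ^ 2 ≤ ∫ x, lap (lap φ) x ^ 2)
    {R : ℝ} (hR : 0 < R) {φ : EuclideanSpace ℝ (Fin n) → ℝ} (hφ : ContDiff ℝ ∞ φ)
    (hφc : HasCompactSupport φ) :
    p * ∫ x, (R ^ 8 * W (R • x)) * φ x ^ 2 ≤ ∫ x, lap (lap φ) x ^ 2 := by
  have h := hst (fun x => φ (R⁻¹ • x)) (contDiff_comp_smul hφ R⁻¹)
    (hφc.comp_homeomorph (Homeomorph.smulOfNeZero R⁻¹ (inv_ne_zero hR.ne')))
  rw [lap_lap_comp_smul hφ] at h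
  have c1 := Measure.integral_comp_smul (volume : Measure (EuclideanSpace ℝ (Fin n)))
    (fun y => W y * φ (R⁻¹ • y) ^ 2) R
  have c2 := Measure.integral_comp_smul (volume : Measure (EuclideanSpace ℝ (Fin n)))
    (fun y => (R⁻¹ ^ 4 * lap (lap φ) (R⁻¹ • y)) ^ 2) R
  simp only [inv_smul_smul₀ hR.ne', smul_eq_mul] at c1 c2
  have e1 : ∫ x, (R ^ 8 * W (R • x)) * φ x ^ 2 = R ^ 8 * ∫ x, W (R • x) * φ x ^ 2 := by
    rw [← integral_const_mul]
    congr 1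
    funext x
    ring
  have e2 : ∫ x, lap (lap φ) x ^ 2 = R ^ 8 * ∫ x, (R⁻¹ ^ 4 * lap (lap φ) x) ^ 2 := by
    rw [← integral_const_mul]
    congr 1
    funext x
    field_simp
  rw [e1, e2, c1, c2]
  have := mul_le_mul_of_nonneg_left h
    (show 0 ≤ R ^ 8 * |(R ^ Module.finrank ℝ (EuclideanSpace ℝ (Fin n)))⁻¹| by positivity)
  linarith

lemma setIntegral_ball_comp_smul (F : EuclideanSpace ℝ (Fin n) → ℝ) {R : ℝ} (hR : 0 < R)
    (r : ℝ) : ∫ x in Metric.ball (0 : EuclideanSpace ℝ (Fin n)) r, F (R • x) =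
      (R ^ n)⁻¹ * ∫ x in Metric.ball (0 : EuclideanSpace ℝ (Fin n)) (R * r), F x := by
  rw [Measure.setIntegral_comp_smul_of_pos volume F _ hR, smul_ball hR.ne']
  simp [abs_of_pos hR]

end Scaling

lemma sq_mul_pow_le_of_absorb {a t R ε p : ℝ} (ha : 0 ≤ a) (ht0 : 0 ≤ t) (ht1 : t ≤ 1)
    (hR : 0 < R) (hε : 0 < ε) (hp : 1 < p) {k : ℕ} (hk : 16 / (p - 1) + 1 ≤ k) :
    a ^ 2 * t ^ (2 * k) ≤ ε * ((R ^ 8 * a ^ (p - 1)) * a ^ 2 * t ^ (2 * k + 8)) +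
      ε ^ (-(2 / (p - 1))) * R ^ (-(16 / (p - 1))) * t := by
  have hp1 : 0 < p - 1 := by linarith
  have hs : 0 < 16 / (p - 1) := by positivity
  have hk0 : k ≠ 0 := by
    rintro rfl
    norm_num at hk
    linarith
  rcases ht0.eq_or_lt with rfl | ht
  · simp [hk0]
  by_cases hcase : 1 ≤ ε * (R ^ 8 * a ^ (p - 1)) * t ^ 8
  · have h1 : 0 ≤ ε ^ (-(2 / (p - 1))) * R ^ (-(16 / (p - 1))) * t := by positivity
    have h2 := mul_le_mul_of_nonneg_left hcase (show 0 ≤ a ^ 2 * t ^ (2 * k) by positivity)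
    have h3 : ε * ((R ^ 8 * a ^ (p - 1)) * a ^ 2 * t ^ (2 * k + 8)) =
        a ^ 2 * t ^ (2 * k) * (ε * (R ^ 8 * a ^ (p - 1)) * t ^ 8) := by ring
    linarith
  · push Not at hcase
    have hy : a ^ (p - 1) ≤ (ε * R ^ 8 * t ^ 8)⁻¹ := by
      rw [← one_div, le_div_iff₀ (by positivity)]
      linarith
    have h0 : 0 ≤ ε * ((R ^ 8 * a ^ (p - 1)) * a ^ 2 * t ^ (2 * k + 8)) := by positivity
    have h1 : a ^ 2 ≤ ((ε * R ^ 8 * t ^ 8)⁻¹) ^ (2 / (p - 1)) := by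
      have h := Real.rpow_le_rpow (by positivity) hy (show 0 ≤ 2 / (p - 1) by positivity)
      rwa [← Real.rpow_mul ha, mul_div_cancel₀ _ hp1.ne', Real.rpow_two] at h
    have h2 : ((ε * R ^ 8 * t ^ 8)⁻¹) ^ (2 / (p - 1)) =
        ε ^ (-(2 / (p - 1))) * R ^ (-(16 / (p - 1))) * t ^ (-(16 / (p - 1))) := by
      have e : -(16 / (p - 1)) = (8 : ℕ) * (-(2 / (p - 1))) := by
        push_cast
        ring
      rw [Real.inv_rpow (by positivity), ← Real.rpow_neg (by positivity),
        Real.mul_rpow (by positivity) (by positivity), Real.mul_rpow (by positivity) (by positivity),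
        e, Real.rpow_mul hR.le, Real.rpow_mul ht.le, Real.rpow_natCast, Real.rpow_natCast]
    have h3 : t ^ (-(16 / (p - 1))) * t ^ (2 * k) ≤ t := by
      rw [← Real.rpow_natCast, ← Real.rpow_add ht]
      refine (Real.rpow_le_rpow_of_exponent_ge ht ht1 (?_ : (1 : ℝ) ≤ _)).trans_eq
        (Real.rpow_one t)
      push_cast
      linarith
    rw [h2] at h1
    have h4 := mul_le_mul_of_nonneg_right h1 (show 0 ≤ t ^ (2 * k) by positivity)
    have h5 := mul_le_mul_of_nonneg_left h3
      (show 0 ≤ ε ^ (-(2 / (p - 1))) * R ^ (-(16 / (p - 1))) by positivity)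
    linarith

lemma exists_rescaled_energy_le (n : ℕ) {p : ℝ} (hp : 1 < p) :
    ∃ C, 0 < C ∧ ∀ (R : ℝ) (v : EuclideanSpace ℝ (Fin n) → ℝ), 0 < R → ContDiff ℝ ∞ v →
      (∀ x, lap (lap (lap (lap v))) x = (R ^ 8 * |v x| ^ (p - 1)) * v x) →
      (∀ φ : EuclideanSpace ℝ (Fin n) → ℝ, ContDiff ℝ ∞ φ → HasCompactSupport φ →
        p * ∫ x, (R ^ 8 * |v x| ^ (p - 1)) * φ x ^ 2 ≤ ∫ x, lap (lap φ) x ^ 2) →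
      ∫ x in Metric.ball (0 : EuclideanSpace ℝ (Fin n)) 1,
          ((R ^ 8 * |v x| ^ (p - 1)) * v x ^ 2 + lap (lap v) x ^ 2) ≤
        C * ∫ x in Metric.ball (0 : EuclideanSpace ℝ (Fin n)) 2, v x ^ 2 ∧
      ∫ x in Metric.ball (0 : EuclideanSpace ℝ (Fin n)) 1,
          ((R ^ 8 * |v x| ^ (p - 1)) * v x ^ 2 + lap (lap v) x ^ 2) ≤
        C * R ^ (-(16 / (p - 1))) := by
  have hp1 : 0 < p - 1 := by linarith
  let ψ : ContDiffBump (0 : EuclideanSpace ℝ (Fin n)) := ⟨1, 2, one_pos, one_lt_two⟩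
  have hψ : ContDiff ℝ ∞ ψ := ψ.contDiff
  have hc : HasCompactSupport ψ := ψ.hasCompactSupport
  have hψ0 : ∀ x, 0 ≤ ψ x := fun x => ψ.nonneg
  have hψ1 : ∀ x, ψ x ≤ 1 := fun x => ψ.le_one
  have hsupp : ∀ x, x ∉ Metric.ball (0 : EuclideanSpace ℝ (Fin n)) 2 → ψ x = 0 := fun x hx =>
    ψ.zero_of_le_dist (by simpa using hx)
  have hone : ∀ x ∈ Metric.ball (0 : EuclideanSpace ℝ (Fin n)) 1, ψ x = 1 := fun x hx =>
    ψ.one_of_mem_closedBall (Metric.ball_subset_closedBall hx)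
  obtain ⟨k, hk⟩ := exists_nat_ge (16 / (p - 1) + 1)
  have hk0 : k ≠ 0 := by
    rintro rfl
    have : 0 < 16 / (p - 1) := by positivity
    norm_num at hk
    linarith
  obtain ⟨C, hC, hE⟩ := exists_weighted_energy_le hψ hψ0 hc hk0 hp
  set ε : ℝ := 1 / (2 * (C + 1)) with hε
  have hε0 : 0 < ε := by positivity
  set M : ℝ := ε ^ (-(2 / (p - 1))) with hM
  have hM0 : 0 ≤ M := by positivity
  have hI0 : 0 ≤ ∫ x, ψ x := integral_nonneg hψ0
  refine ⟨C + 2 * C * (M * ∫ x, ψ x) + 1, by positivity, fun R v hR hv heq hst => ?_⟩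
  have hVc : Continuous fun x => R ^ 8 * |v x| ^ (p - 1) :=
    continuous_const.mul (hv.continuous.abs.rpow_const fun x => Or.inr hp1.le)
  have hen := hE v (fun x => R ^ 8 * |v x| ^ (p - 1)) hv heq hst
  have iV : Integrable fun x => (R ^ 8 * |v x| ^ (p - 1)) * v x ^ 2 * ψ x ^ (2 * k + 8) :=
    integrable_mul_pow hψ hc (by omega) (hVc.mul (hv.continuous.pow 2))
  have iL : Integrable fun x => lap (lap v) x ^ 2 * ψ x ^ (2 * k + 8) :=
    integrable_mul_pow hψ hc (by omega) (hv.lap.lap.continuous.pow 2)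
  have iS : Integrable fun x => v x ^ 2 * ψ x ^ (2 * k) :=
    integrable_mul_pow hψ hc (by omega) (hv.continuous.pow 2)
  have iψ : Integrable ψ := hψ.continuous.integrable_of_hasCompactSupport hc
  set X := ∫ x, (R ^ 8 * |v x| ^ (p - 1)) * v x ^ 2 * ψ x ^ (2 * k + 8) with hX
  set Y := ∫ x, lap (lap v) x ^ 2 * ψ x ^ (2 * k + 8) with hY
  set S := ∫ x, v x ^ 2 * ψ x ^ (2 * k) with hS
  have hX0 : 0 ≤ X := integral_nonneg fun x => by
    have := hψ0 x
    positivity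
  have hY0 : 0 ≤ Y := integral_nonneg fun x => by
    have := hψ0 x
    positivity
  have hleft : ∫ x in Metric.ball (0 : EuclideanSpace ℝ (Fin n)) 1,
      ((R ^ 8 * |v x| ^ (p - 1)) * v x ^ 2 + lap (lap v) x ^ 2) ≤ X + Y := by
    rw [hX, hY, ← integral_add iV iL]
    have e : ∫ x in Metric.ball (0 : EuclideanSpace ℝ (Fin n)) 1,
        ((R ^ 8 * |v x| ^ (p - 1)) * v x ^ 2 + lap (lap v) x ^ 2) =
        ∫ x in Metric.ball (0 : EuclideanSpace ℝ (Fin n)) 1,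
          ((R ^ 8 * |v x| ^ (p - 1)) * v x ^ 2 * ψ x ^ (2 * k + 8) +
            lap (lap v) x ^ 2 * ψ x ^ (2 * k + 8)) :=
      setIntegral_congr_fun measurableSet_ball fun x hx => by simp [hone x hx]
    rw [e]
    refine setIntegral_le_integral (iV.add iL) (Filter.Eventually.of_forall fun x => ?_)
    have := hψ0 x
    simp only [Pi.zero_apply]
    positivity
  have hright : S ≤ ∫ x in Metric.ball (0 : EuclideanSpace ℝ (Fin n)) 2, v x ^ 2 := by
    rw [hS, ← setIntegral_eq_integral_of_forall_compl_eq_zero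
      (s := Metric.ball (0 : EuclideanSpace ℝ (Fin n)) 2) fun x hx => by simp [hsupp x hx, hk0]]
    refine setIntegral_mono_on iS.integrableOn ?_ measurableSet_ball fun x _ =>
      mul_le_of_le_one_right (sq_nonneg _) (pow_le_one₀ (hψ0 x) (hψ1 x))
    exact ((hv.continuous.pow 2).continuousOn.integrableOn_compact
      (isCompact_closedBall _ _)).mono_set Metric.ball_subset_closedBall
  have habs : S ≤ ε * X + M * R ^ (-(16 / (p - 1))) * ∫ x, ψ x := by
    rw [hX, ← integral_const_mul, ← integral_const_mul, ← integral_add (iV.const_mul ε)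
      (iψ.const_mul _)]
    refine integral_mono iS ((iV.const_mul ε).add (iψ.const_mul _)) fun x => ?_
    simpa only [sq_abs, Pi.add_apply] using
      sq_mul_pow_le_of_absorb (abs_nonneg (v x)) (hψ0 x) (hψ1 x) hR hε0 hp hk
  have hRp : 0 ≤ R ^ (-(16 / (p - 1))) := by positivity
  have hJ0 : 0 ≤ ∫ x in Metric.ball (0 : EuclideanSpace ℝ (Fin n)) 2, v x ^ 2 :=
    integral_nonneg fun x => sq_nonneg _
  constructor
  · have h1 := mul_le_mul_of_nonneg_left hright hC
    have h2 : 0 ≤ (2 * C * (M * ∫ x, ψ x) + 1) *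
        ∫ x in Metric.ball (0 : EuclideanSpace ℝ (Fin n)) 2, v x ^ 2 := by positivity
    linarith
  · have h1 := mul_le_mul_of_nonneg_left habs hC
    have h2 : 0 ≤ (C + 1) * R ^ (-(16 / (p - 1))) := by positivity
    have h3 : C * ε ≤ 1 / 2 := by
      rw [hε, mul_one_div, div_le_iff₀ (by positivity)]
      linarith
    have h4 := mul_le_mul_of_nonneg_right h3 hX0
    linarith

/-- Energy estimates for stable solutions of `Δ⁴ u = |u|^{p-1} u` in `ℝⁿ`:
`∫_{B_R} (|u|^{p+1} + |Δ²u|²) ≤ C R⁻⁸ ∫_{B_{2R}} u²` and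
`∫_{B_R} (|u|^{p+1} + |Δ²u|²) ≤ C R^{n - 8(p+1)/(p-1)}`. -/
theorem stable_solution_energy_estimates
    (n : ℕ) (hn : 1 ≤ n) (p : ℝ) (hp : 1 < p)
    (u : EuclideanSpace ℝ (Fin n) → ℝ) (hu : ContDiff ℝ (⊤ : ℕ∞) u)
    (heq : ∀ x, lap^[4] u x = |u x| ^ (p - 1) * u x)
    (hstable : ∀ φ : EuclideanSpace ℝ (Fin n) → ℝ, ContDiff ℝ (⊤ : ℕ∞) φ → HasCompactSupport φ →
      p * ∫ x, |u x| ^ (p - 1) * (φ x) ^ 2 ≤ ∫ x, (lap^[2] φ x) ^ 2) :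
    ∃ C > 0, ∀ R > 0,
      (∫ x in Metric.ball (0 : EuclideanSpace ℝ (Fin n)) R,
          (|u x| ^ (p + 1) + (lap^[2] u x) ^ 2)) ≤
        C * R ^ (-(8 : ℝ)) *
          ∫ x in Metric.ball (0 : EuclideanSpace ℝ (Fin n)) (2 * R), (u x) ^ 2 ∧
      (∫ x in Metric.ball (0 : EuclideanSpace ℝ (Fin n)) R,
          (|u x| ^ (p + 1) + (lap^[2] u x) ^ 2)) ≤
        C * R ^ ((n : ℝ) - 8 * (p + 1) / (p - 1)) := by
  have hp1 : 0 < p - 1 := by linarith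
  obtain ⟨C, hC, hE⟩ := exists_rescaled_energy_le n hp
  refine ⟨C, hC, fun R hR => ?_⟩
  change 0 < R at hR
  have heqR : ∀ x, lap (lap (lap (lap fun x => u (R • x)))) x =
      (R ^ 8 * |u (R • x)| ^ (p - 1)) * u (R • x) := by
    intro x
    have h : lap (lap (lap (lap u))) (R • x) = |u (R • x)| ^ (p - 1) * u (R • x) := heq (R • x)
    have hs := contDiff_comp_smul hu.lap.lap R
    rw [lap_lap_comp_smul hu, lap_const_mul hs, lap_const_mul hs.lap, lap_lap_comp_smul hu.lap.lap]
    beta_reduce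
    rw [h]
    ring
  obtain ⟨h1, h2⟩ := hE R (fun x => u (R • x)) hR (contDiff_comp_smul hu R) heqR
    fun φ hφ hφc => stable_comp_smul (W := fun x => |u x| ^ (p - 1)) hstable hR hφ hφc
  have hI : ∫ x in Metric.ball (0 : EuclideanSpace ℝ (Fin n)) 1,
      ((R ^ 8 * |u (R • x)| ^ (p - 1)) * u (R • x) ^ 2 + lap (lap fun x => u (R • x)) x ^ 2) =
      R ^ 8 * ((R ^ n)⁻¹ * ∫ x in Metric.ball (0 : EuclideanSpace ℝ (Fin n)) R,
        (|u x| ^ (p + 1) + lap^[2] u x ^ 2)) := by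
    have h := setIntegral_ball_comp_smul (n := n)
      (fun x => |u x| ^ (p + 1) + lap^[2] u x ^ 2) hR 1
    rw [mul_one] at h
    rw [← h, ← integral_const_mul]
    congr 1
    funext x
    have e : |u (R • x)| ^ (p + 1) = |u (R • x)| ^ (p - 1) * u (R • x) ^ 2 := by
      rw [← sq_abs (u (R • x)), ← Real.rpow_two,
        ← Real.rpow_add_of_nonneg (abs_nonneg _) hp1.le (by norm_num)]
      congr 1
      ring
    rw [e, lap_lap_comp_smul hu]
    simp only [Function.iterate_succ, Function.iterate_zero, Function.comp_apply, id_eq]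
    ring
  have hJ := setIntegral_ball_comp_smul (n := n) (fun x => u x ^ 2) hR 2
  rw [hI] at h1 h2
  rw [hJ, mul_comm R 2] at h1
  set I := ∫ x in Metric.ball (0 : EuclideanSpace ℝ (Fin n)) R,
    (|u x| ^ (p + 1) + lap^[2] u x ^ 2)
  set J := ∫ x in Metric.ball (0 : EuclideanSpace ℝ (Fin n)) (2 * R), u x ^ 2
  have hR8 : R ^ (-(8 : ℝ)) = (R ^ 8)⁻¹ := by
    rw [Real.rpow_neg hR.le]
    norm_cast
  have hI' : I = (R ^ 8)⁻¹ * R ^ n * (R ^ 8 * ((R ^ n)⁻¹ * I)) := by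
    field_simp
  constructor
  · rw [hI', hR8]
    refine (mul_le_mul_of_nonneg_left h1 (by positivity)).trans_eq ?_
    field_simp
  · rw [hI']
    refine (mul_le_mul_of_nonneg_left h2 (by positivity)).trans_eq ?_
    have e : (n : ℝ) - 8 * (p + 1) / (p - 1) = -8 + n + -(16 / (p - 1)) := by
      field_simp
      ring
    rw [e, Real.rpow_add hR, Real.rpow_add hR, hR8, Real.rpow_natCast]
    ring
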